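/- arXiv:quant-ph/9808030 — 6 statements merged into one kernel-verified Lean document; each statement's English description precedes it below -/
import Mathlib

section
/- Let S = {ψ_j = ⊗_{i=1}^m φ_{i,j} : j = 1,…,n} be a set of pairwise orthogonal unit product vectors spanning a proper subspace of H = ⊗_{i=1}^m ℂ^{d_i}. Then S is extendible (i.e., there exists a nonzero product vector in H orthogonal to every ψ_j) if and only if there exists a partition of the index set {1,…,n} into m disjoint (possibly empty) subsets S_1,…,S_m such that for every i = 1,…,m the span of {φ_{i,j} : j ∈ S_i} has dimension strictly less than d_i. -/
/-!
STATEMENT 0 (Lemma 1 of Bennett–DiVincenzo–Mor–Shor–Smolin–Terhal,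
"Unextendible Product Bases and Bound Entanglement").

A product basis S = {ψ_j = ⊗_i φ_{i,j}} in ⊗_{i=1}^m ℂ^{d_i} is extendible
iff there is a partition of {1,…,n} into subsets S_1,…,S_m such that for each
party i the span of {φ_{i,j} : j ∈ S_i} has dimension < d_i.
-/

open ComplexConjugate

noncomputable section

/-- The standard hermitian inner product on `ι → ℂ` (antilinear in the first slot). -/
def ip {ι : Type*} [Fintype ι] (x y : ι → ℂ) : ℂ := ∑ i, conj (x i) * y i

/-- The product (tensor/Kronecker) vector `⊗_i φ_i` of local vectors `φ i : Fin (d i) → ℂ`,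
as a vector on the multi-index set `∀ i, Fin (d i)`. -/
def prodVec {m : ℕ} {d : Fin m → ℕ} (φ : ∀ i, Fin (d i) → ℂ) : (∀ i, Fin (d i)) → ℂ :=
  fun f => ∏ i, φ i (f i)

theorem ip_eq_star_dotProduct {ι : Type*} [Fintype ι] (x y : ι → ℂ) :
    ip x y = star x ⬝ᵥ y := rfl

/-- The inner product of two product vectors is the product of the local inner products. -/
theorem ip_prodVec {m : ℕ} {d : Fin m → ℕ} (φ χ : ∀ i, Fin (d i) → ℂ) :
    ip (prodVec φ) (prodVec χ) = ∏ i, ip (φ i) (χ i) := by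
  simp only [ip, prodVec, Finset.prod_univ_sum, Fintype.piFinset_univ, map_prod,
    Finset.prod_mul_distrib]

/-- A set of vectors spans a subspace of less than full dimension iff some nonzero vector is
orthogonal to all of them. -/
theorem finrank_span_lt_card_iff_exists_ip_eq_zero {ι : Type*} [Fintype ι] (s : Set (ι → ℂ)) :
    Module.finrank ℂ (Submodule.span ℂ s) < Fintype.card ι ↔
      ∃ χ : ι → ℂ, χ ≠ 0 ∧ ∀ x ∈ s, ip x χ = 0 := by
  classical
  constructor
  · intro h
    have hlt : Submodule.span ℂ s < ⊤ := by
      refine lt_top_iff_ne_top.mpr fun htop => ?_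
      rw [htop, finrank_top, Module.finrank_fintype_fun_eq_card] at h
      exact h.false
    obtain ⟨f, hf, hle⟩ := Submodule.exists_le_ker_of_lt_top _ hlt
    have hip (x : ι → ℂ) : ip x (fun i => conj (f (Pi.single i 1))) = conj (f x) := by
      rw [LinearMap.pi_apply_eq_sum_univ f x]
      have hsingle (i : ι) : (fun j => if i = j then (1 : ℂ) else 0) = Pi.single i 1 := by
        ext j
        simp [Pi.single_apply, eq_comm]
      simp [ip, hsingle]
    refine ⟨fun i => conj (f (Pi.single i 1)), fun h0 => hf ?_, fun x hx => ?_⟩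
    · ext i
      simpa using congrFun h0 i
    · rw [hip, LinearMap.mem_ker.mp (hle (Submodule.subset_span hx)), map_zero]
  · rintro ⟨χ, hχ, h⟩
    rw [← Module.finrank_fintype_fun_eq_card (R := ℂ) (η := ι)]
    refine Submodule.finrank_lt fun htop => hχ ?_
    have hmem : χ ∈ Submodule.span ℂ s := htop ▸ Submodule.mem_top
    have hspan : ∀ x ∈ Submodule.span ℂ s, ip x χ = 0 := by
      intro x hx
      induction hx using Submodule.span_induction with
      | mem x hx => exact h x hx
      | zero => simp [ip]
      | add x y _ _ hx hy =>
        rw [ip_eq_star_dotProduct] at hx hy ⊢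
        rw [star_add, add_dotProduct, hx, hy, add_zero]
      | smul a x _ hx =>
        rw [ip_eq_star_dotProduct] at hx ⊢
        rw [star_smul, smul_dotProduct, hx, smul_zero]
    open scoped ComplexOrder in
    exact dotProduct_star_self_eq_zero.mp (by simpa [ip_eq_star_dotProduct] using hspan χ hmem)

/-- **Lemma 1.** An (incomplete) orthogonal product basis is extendible iff there exists a
partition `P` of the index set among the `m` parties such that each party's local rank is
strictly less than its local dimension. -/
theorem extendible_iff_partition {m n : ℕ} {d : Fin m → ℕ}
    (φ : ∀ i : Fin m, Fin n → (Fin (d i) → ℂ))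
    (hnz : ∀ i j, φ i j ≠ 0)
    (hunit : ∀ j, ip (prodVec fun i => φ i j) (prodVec fun i => φ i j) = 1)
    (horth : ∀ j k, j ≠ k →
      ip (prodVec fun i => φ i j) (prodVec fun i => φ i k) = 0)
    (hproper : Submodule.span ℂ (Set.range fun j => prodVec fun i => φ i j) ≠ ⊤) :
    (∃ χ : ∀ i, Fin (d i) → ℂ, (∀ i, χ i ≠ 0) ∧
        ∀ j, ip (prodVec fun i => φ i j) (prodVec χ) = 0)
    ↔
    (∃ P : Fin n → Fin m, ∀ i,
        Module.finrank ℂ (Submodule.span ℂ (φ i '' {j | P j = i})) < d i) := by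
  have hlocal (i : Fin m) (s : Set (Fin (d i) → ℂ)) :=
    finrank_span_lt_card_iff_exists_ip_eq_zero s
  simp only [Fintype.card_fin] at hlocal
  simp only [ip_prodVec, Finset.prod_eq_zero_iff, Finset.mem_univ, true_and, hlocal,
    Set.forall_mem_image, Set.mem_ofPred_eq]
  constructor
  · rintro ⟨χ, hχ, h⟩
    choose P hP using h
    refine ⟨P, fun i => ⟨χ i, hχ i, ?_⟩⟩
    rintro j rfl
    exact hP j
  · rintro ⟨P, h⟩
    choose χ hχ h using h
    exact ⟨χ, hχ, fun j => ⟨P j, h (P j) rfl⟩⟩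

end
end

section
/- Every unextendible product basis in ⊗_{i=1}^m ℂ^{d_i} contains at least Σ_{i=1}^m (d_i − 1) + 1 elements; equivalently, for every set of at most Σ_{i=1}^m (d_i − 1) pairwise orthogonal unit product vectors in ⊗_{i=1}^m ℂ^{d_i} there exists a nonzero product vector orthogonal to all of them. -/
/-!
STATEMENT 1. Every unextendible product basis in ⊗_{i=1}^m ℂ^{d_i} has at least
Σ_i (d_i − 1) + 1 elements; equivalently, any set of at most Σ_i (d_i − 1) pairwise
orthogonal unit product vectors admits a nonzero orthogonal product vector.
-/

open ComplexConjugate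

noncomputable section

/-- Fewer vectors than the dimension leave a nonzero vector orthogonal to all of them. -/
theorem exists_ne_zero_ip_eq_zero {ι κ : Type*} [Fintype ι] [Fintype κ]
    (v : κ → ι → ℂ) (h : Fintype.card κ < Fintype.card ι) :
    ∃ x : ι → ℂ, x ≠ 0 ∧ ∀ k, ip (v k) x = 0 := by
  have hker := LinearMap.ker_ne_bot_of_finrank_lt
    (f := Matrix.mulVecLin (Matrix.of fun k i => conj (v k i))) (by simpa using h)
  obtain ⟨x, hx, hx0⟩ := Submodule.exists_mem_ne_zero_of_ne_bot hker
  exact ⟨x, hx0, fun k => congrFun hx k⟩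

/-- **Lower bound on the size of a UPB.** If a set of `n` pairwise orthogonal unit product
vectors spanning a proper subspace of `⊗_i ℂ^{d_i}` is unextendible (no nonzero product
vector is orthogonal to all of its members), then `n ≥ Σ_i (d_i − 1) + 1`. -/
theorem upb_size_lower_bound {m n : ℕ} {d : Fin m → ℕ}
    (φ : ∀ i : Fin m, Fin n → (Fin (d i) → ℂ))
    (hnz : ∀ i j, φ i j ≠ 0)
    (hunit : ∀ j, ip (prodVec fun i => φ i j) (prodVec fun i => φ i j) = 1)
    (horth : ∀ j k, j ≠ k →
      ip (prodVec fun i => φ i j) (prodVec fun i => φ i k) = 0)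
    (hproper : Submodule.span ℂ (Set.range fun j => prodVec fun i => φ i j) ≠ ⊤)
    (hupb : ¬ ∃ χ : ∀ i, Fin (d i) → ℂ, (∀ i, χ i ≠ 0) ∧
        ∀ j, ip (prodVec fun i => φ i j) (prodVec χ) = 0) :
    (∑ i, (d i - 1)) + 1 ≤ n := by
  have hd : ∀ i, 0 < d i := by
    intro i
    by_contra hi
    have : IsEmpty (∀ i, Fin (d i)) := ⟨fun f => hi (f i).pos⟩
    exact hproper (Subsingleton.elim _ _)
  by_contra! hn
  obtain ⟨e⟩ : Nonempty (Fin n ↪ Σ i, Fin (d i - 1)) :=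
    Function.Embedding.nonempty_of_card_le (by simpa using Nat.le_of_lt_succ hn)
  have hlocal : ∀ i, ∃ x : Fin (d i) → ℂ, x ≠ 0 ∧
      ∀ j : {j // (e j).1 = i}, ip (φ i j) x = 0 := by
    intro i
    refine exists_ne_zero_ip_eq_zero (fun j : {j // (e j).1 = i} => φ i j) ?_
    have hcard : Fintype.card {j // (e j).1 = i} ≤ Fintype.card (Fin (d i - 1)) := by
      refine Fintype.card_le_of_injective
        (fun j => Fin.cast (congrArg (fun l => d l - 1) j.2) (e j).2) ?_
      rintro ⟨j, rfl⟩ ⟨k, hk⟩ hjk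
      refine Subtype.ext (e.injective (Sigma.ext hk.symm ?_))
      exact (Fin.heq_ext_iff (congrArg (fun l => d l - 1) hk.symm)).2 (congrArg Fin.val hjk)
    have := hd i
    simp only [Fintype.card_fin] at hcard ⊢
    omega
  choose χ hχ hort using hlocal
  refine hupb ⟨χ, hχ, fun j => ?_⟩
  rw [ip_prodVec]
  exact Finset.prod_eq_zero (Finset.mem_univ (e j).1) (hort _ ⟨j, rfl⟩)

end
end

section
/- The five Pyramid states ψ_j = v_j ⊗ v_{2j mod 5}, j = 0,…,4, are pairwise orthogonal unit vectors in ℂ³ ⊗ ℂ³, and there is no nonzero product vector a ⊗ b (a, b ∈ ℂ³ nonzero) orthogonal to all five; that is, Pyramid is an unextendible product basis of ℂ³ ⊗ ℂ³. -/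
/-!
STATEMENT 2. The five **Pyramid** states ψ_j = v_j ⊗ v_{2j mod 5} form an unextendible
product basis of ℂ³ ⊗ ℂ³: they are pairwise orthogonal unit vectors, and no nonzero
product vector a ⊗ b is orthogonal to all five.
-/

open ComplexConjugate

noncomputable section

/-- Bipartite product (Kronecker) vector `a ⊗ b`. -/
def pv2 {ι κ : Type*} (a : ι → ℂ) (b : κ → ℂ) : ι × κ → ℂ := fun p => a p.1 * b p.2

/-- Height of the pentagonal pyramid: `h = (1/2)√(1+√5)`. -/
def pyrH : ℝ := (1 / 2) * Real.sqrt (1 + Real.sqrt 5)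

/-- Normalization `N = 2/√(5+√5)`. -/
def pyrN : ℝ := 2 / Real.sqrt (5 + Real.sqrt 5)

/-- The Pyramid vectors `v_j = N (cos(2πj/5), sin(2πj/5), h) ∈ ℝ³ ⊂ ℂ³`. -/
def pyrV (j : Fin 5) : Fin 3 → ℂ :=
  ![((pyrN * Real.cos (2 * Real.pi * (j : ℕ) / 5) : ℝ) : ℂ),
    ((pyrN * Real.sin (2 * Real.pi * (j : ℕ) / 5) : ℝ) : ℂ),
    ((pyrN * pyrH : ℝ) : ℂ)]

/-- The Pyramid states `ψ_j = v_j ⊗ v_{2j mod 5}` (multiplication in `Fin 5` is mod 5). -/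
def pyrPsi (j : Fin 5) : Fin 3 × Fin 3 → ℂ := pv2 (pyrV j) (pyrV (2 * j))

theorem ip_pv2 {ι κ : Type*} [Fintype ι] [Fintype κ] (a c : ι → ℂ) (b d : κ → ℂ) :
    ip (pv2 a b) (pv2 c d) = ip a c * ip b d := by
  simp only [ip, pv2, Fintype.sum_prod_type, Finset.sum_mul_sum, map_mul]
  refine Finset.sum_congr rfl fun i _ => Finset.sum_congr rfl fun j _ => ?_
  ring

theorem ip_pyrV (j : Fin 5) (a : Fin 3 → ℂ) :
    ip (pyrV j) a = pyrN * (a 0 * (Real.cos (2 * Real.pi * (j : ℕ) / 5) : ℝ)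
      + a 1 * (Real.sin (2 * Real.pi * (j : ℕ) / 5) : ℝ) + pyrH * a 2) := by
  simp only [ip, pyrV, Fin.sum_univ_three, Matrix.cons_val_zero, Matrix.cons_val_one,
    Matrix.cons_val, Complex.ofReal_mul, map_mul, Complex.conj_ofReal]
  ring

theorem pyrH_sq : pyrH ^ 2 = (1 + √5) / 4 := by
  rw [pyrH, mul_pow, Real.sq_sqrt (by positivity)]
  ring

theorem pyrN_sq : pyrN ^ 2 = 4 / (5 + √5) := by
  rw [pyrN, div_pow, Real.sq_sqrt (by positivity)]
  norm_num

theorem pyrH_pos : 0 < pyrH := by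
  unfold pyrH
  positivity

theorem pyrN_pos : 0 < pyrN := by
  unfold pyrN
  positivity

theorem ip_pyrV_pyrV (j k : Fin 5) :
    ip (pyrV j) (pyrV k) =
      ((pyrN ^ 2 * (Real.cos (2 * Real.pi * ((j : ℕ) - (k : ℕ)) / 5) + pyrH ^ 2) : ℝ) : ℂ) := by
  have h : 2 * Real.pi * ((j : ℕ) - (k : ℕ)) / 5 =
      2 * Real.pi * (j : ℕ) / 5 - 2 * Real.pi * (k : ℕ) / 5 := by ring
  rw [ip_pyrV, h, Real.cos_sub]
  simp only [pyrV, Matrix.cons_val_zero, Matrix.cons_val_one, Matrix.cons_val]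
  push_cast
  ring

theorem ip_pyrV_self (j : Fin 5) : ip (pyrV j) (pyrV j) = 1 := by
  rw [ip_pyrV_pyrV, sub_self, pyrN_sq, pyrH_sq, mul_zero, zero_div, Real.cos_zero]
  norm_cast
  have : 5 + √5 ≠ 0 := by positivity
  field_simp
  ring

theorem cos_four_pi_div_five : Real.cos (4 * Real.pi / 5) = -(1 + √5) / 4 := by
  rw [show 4 * Real.pi / 5 = Real.pi - Real.pi / 5 by ring, Real.cos_pi_sub,
    Real.cos_pi_div_five]
  ring

theorem cos_six_pi_div_five : Real.cos (6 * Real.pi / 5) = -(1 + √5) / 4 := by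
  rw [← cos_four_pi_div_five, ← Real.cos_two_pi_sub]
  ring_nf

theorem ip_pyrV_eq_zero {j k : Fin 5} (h : k = j + 2 ∨ k = j + 3) :
    ip (pyrV j) (pyrV k) = 0 := by
  have key : Real.cos (2 * Real.pi * ((j : ℕ) - (k : ℕ)) / 5) = -(1 + √5) / 4 := by
    have hd : (k : ℕ) = j + 2 ∨ (k : ℕ) = j + 3 ∨ (j : ℕ) = k + 2 ∨ (j : ℕ) = k + 3 := by
      revert j k
      decide
    rcases hd with h | h | h | h <;> rw [h] <;> push_cast
    · rw [← cos_four_pi_div_five, ← Real.cos_neg]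
      ring_nf
    · rw [← cos_six_pi_div_five, ← Real.cos_neg]
      ring_nf
    · rw [← cos_four_pi_div_five]
      ring_nf
    · rw [← cos_six_pi_div_five]
      ring_nf
  rw [ip_pyrV_pyrV, key, pyrH_sq]
  norm_cast
  ring

theorem sin_pi_mul_sub_div_five_ne_zero {j k : Fin 5} (h : j ≠ k) :
    Real.sin (Real.pi * ((j : ℕ) - (k : ℕ)) / 5) ≠ 0 := by
  have hj : ((j : ℕ) : ℝ) < 5 := by exact_mod_cast j.isLt
  have hk : ((k : ℕ) : ℝ) < 5 := by exact_mod_cast k.isLt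
  have hj0 : (0 : ℝ) ≤ (j : ℕ) := by positivity
  have hk0 : (0 : ℝ) ≤ (k : ℕ) := by positivity
  have hne : ((j : ℕ) : ℝ) - (k : ℕ) ≠ 0 := by
    rw [sub_ne_zero]
    exact_mod_cast fun e => h (Fin.ext e)
  have hpi := Real.pi_pos
  rw [Ne, Real.sin_eq_zero_iff_of_lt_of_lt (by nlinarith) (by nlinarith)]
  positivity

theorem sin_add_sin_sub_sin_add (x y : ℝ) :
    Real.sin (2 * x) + Real.sin (2 * y) - Real.sin (2 * (x + y)) =
      4 * Real.sin x * Real.sin y * Real.sin (x + y) := by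
  rw [mul_add, Real.sin_add (2 * x), Real.sin_add x]
  simp only [Real.sin_two_mul, Real.cos_two_mul]
  linear_combination (-4 * Real.sin y * Real.cos y) * Real.sin_sq_add_cos_sq x
    + (-4 * Real.sin x * Real.cos x) * Real.sin_sq_add_cos_sq y

/-- Any three of the Pyramid vectors span `ℂ³`. -/
theorem eq_zero_of_ip_pyrV_eq_zero {j k l : Fin 5} (hjk : j ≠ k) (hjl : j ≠ l) (hkl : k ≠ l)
    {a : Fin 3 → ℂ} (hj : ip (pyrV j) a = 0) (hk : ip (pyrV k) a = 0)
    (hl : ip (pyrV l) a = 0) : a = 0 := by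
  have hN : (pyrN : ℂ) ≠ 0 := by exact_mod_cast pyrN_pos.ne'
  have hH : (pyrH : ℂ) ≠ 0 := by exact_mod_cast pyrH_pos.ne'
  have hD := mul_ne_zero (mul_ne_zero (mul_ne_zero four_ne_zero
    (sin_pi_mul_sub_div_five_ne_zero hjk)) (sin_pi_mul_sub_div_five_ne_zero hkl))
    (sin_pi_mul_sub_div_five_ne_zero hjl)
  rw [show Real.pi * ((j : ℕ) - (l : ℕ)) / 5 = Real.pi * ((j : ℕ) - (k : ℕ)) / 5
      + Real.pi * ((k : ℕ) - (l : ℕ)) / 5 by ring, ← sin_add_sin_sub_sin_add,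
    show 2 * (Real.pi * ((j : ℕ) - (k : ℕ)) / 5) =
      2 * Real.pi * (j : ℕ) / 5 - 2 * Real.pi * (k : ℕ) / 5 by ring,
    show 2 * (Real.pi * ((k : ℕ) - (l : ℕ)) / 5) =
      2 * Real.pi * (k : ℕ) / 5 - 2 * Real.pi * (l : ℕ) / 5 by ring,
    show 2 * (Real.pi * ((j : ℕ) - (k : ℕ)) / 5 + Real.pi * ((k : ℕ) - (l : ℕ)) / 5) =
      2 * Real.pi * (j : ℕ) / 5 - 2 * Real.pi * (l : ℕ) / 5 by ring] at hD
  simp only [Real.sin_sub] at hD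
  rw [ip_pyrV, mul_eq_zero, or_iff_right hN] at hj hk hl
  generalize Real.cos (2 * Real.pi * (j : ℕ) / 5) = cj at *
  generalize Real.cos (2 * Real.pi * (k : ℕ) / 5) = ck at *
  generalize Real.cos (2 * Real.pi * (l : ℕ) / 5) = cl at *
  generalize Real.sin (2 * Real.pi * (j : ℕ) / 5) = sj at *
  generalize Real.sin (2 * Real.pi * (k : ℕ) / 5) = sk at *
  generalize Real.sin (2 * Real.pi * (l : ℕ) / 5) = sl at *
  rw [← Complex.ofReal_ne_zero] at hD
  push_cast at hD
  ext i
  fin_cases i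
  · refine (mul_eq_zero.1 ?_).resolve_left hD
    simp only [Fin.zero_eta]
    linear_combination (sl - sk) * hj + (sj - sl) * hk + (sk - sj) * hl
  · refine (mul_eq_zero.1 ?_).resolve_left hD
    simp only [Fin.mk_one]
    linear_combination (ck - cl) * hj + (cl - cj) * hk + (cj - ck) * hl
  · refine (mul_eq_zero.1 ?_).resolve_left (mul_ne_zero hD hH)
    simp only [Fin.reduceFinMk]
    linear_combination (sk * cl - ck * sl) * hj + (sl * cj - cl * sj) * hk
      + (sj * ck - cj * sk) * hl

theorem card_ip_pyrV_eq_zero_le_two {a : Fin 3 → ℂ} (ha : a ≠ 0) :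
    (Finset.univ.filter fun j => ip (pyrV j) a = 0).card ≤ 2 := by
  by_contra! h
  obtain ⟨j, k, l, hj, hk, hl, hjk, hjl, hkl⟩ := Finset.two_lt_card_iff.1 h
  simp only [Finset.mem_filter, Finset.mem_univ, true_and] at hj hk hl
  exact ha (eq_zero_of_ip_pyrV_eq_zero hjk hjl hkl hj hk hl)

/-- **Pyramid is a UPB of ℂ³ ⊗ ℂ³.** -/
theorem pyramid_is_UPB :
    (∀ j, ip (pyrPsi j) (pyrPsi j) = 1) ∧
    (∀ j k, j ≠ k → ip (pyrPsi j) (pyrPsi k) = 0) ∧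
    Submodule.span ℂ (Set.range pyrPsi) ≠ ⊤ ∧
    ¬ ∃ (a b : Fin 3 → ℂ), a ≠ 0 ∧ b ≠ 0 ∧ ∀ j, ip (pyrPsi j) (pv2 a b) = 0 := by
  refine ⟨fun j => ?_, fun j k hjk => ?_, fun h => ?_, ?_⟩
  · rw [pyrPsi, ip_pv2, ip_pyrV_self, ip_pyrV_self, mul_one]
  · have hd : (k = j + 2 ∨ k = j + 3) ∨ (2 * k = 2 * j + 2 ∨ 2 * k = 2 * j + 3) := by
      revert j k
      decide
    rw [pyrPsi, pyrPsi, ip_pv2, mul_eq_zero]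
    exact hd.imp ip_pyrV_eq_zero ip_pyrV_eq_zero
  · have hle := finrank_range_le_card (R := ℂ) pyrPsi
    rw [Set.finrank, h, finrank_top] at hle
    simp at hle
  · rintro ⟨a, b, ha, hb, h⟩
    have hinj : Function.Injective fun j : Fin 5 => 2 * j := by decide
    have hcover : (Finset.univ : Finset (Fin 5)) ⊆
        (Finset.univ.filter fun j => ip (pyrV j) a = 0) ∪
          Finset.univ.filter fun j => ip (pyrV (2 * j)) b = 0 := by
      intro j _
      simpa [pyrPsi, ip_pv2] using h j
    have hb' : (Finset.univ.filter fun j => ip (pyrV (2 * j)) b = 0).card ≤ 2 := by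
      refine le_trans (Finset.card_le_card_of_injOn (fun j => 2 * j) ?_ hinj.injOn)
        (card_ip_pyrV_eq_zero_le_two hb)
      intro j hj
      simpa using hj
    have hcard := (Finset.card_le_card hcover).trans (Finset.card_union_le _ _)
    have ha' := card_ip_pyrV_eq_zero_le_two ha
    rw [Finset.card_univ, Fintype.card_fin] at hcard
    omega

end
end

section
/- The five Tiles states ψ_0 = (1/√2)|0⟩(|0⟩−|1⟩), ψ_1 = (1/√2)(|0⟩−|1⟩)|2⟩, ψ_2 = (1/√2)|2⟩(|1⟩−|2⟩), ψ_3 = (1/√2)(|1⟩−|2⟩)|0⟩, ψ_4 = (1/3)(|0⟩+|1⟩+|2⟩)(|0⟩+|1⟩+|2⟩) are pairwise orthogonal unit vectors in ℂ³ ⊗ ℂ³, and there is no nonzero product vector a ⊗ b orthogonal to all five; that is, Tiles is an unextendible product basis of ℂ³ ⊗ ℂ³. -/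
/-!
STATEMENT 4. The five **Tiles** states form an unextendible product basis of ℂ³ ⊗ ℂ³:
they are pairwise orthogonal unit vectors and no nonzero product vector a ⊗ b is
orthogonal to all five.
-/

open ComplexConjugate

noncomputable section

/-- The standard basis `|0⟩, |1⟩, |2⟩` of ℂ³. -/
def e (i : Fin 3) : Fin 3 → ℂ := Pi.single i 1

/-- The Tiles states:
ψ₀ = (1/√2)|0⟩(|0⟩−|1⟩), ψ₁ = (1/√2)(|0⟩−|1⟩)|2⟩, ψ₂ = (1/√2)|2⟩(|1⟩−|2⟩),
ψ₃ = (1/√2)(|1⟩−|2⟩)|0⟩, ψ₄ = (1/3)(|0⟩+|1⟩+|2⟩)(|0⟩+|1⟩+|2⟩). -/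
def tiles : Fin 5 → (Fin 3 × Fin 3 → ℂ) :=
  ![((Real.sqrt 2 : ℂ))⁻¹ • pv2 (e 0) (e 0 - e 1),
    ((Real.sqrt 2 : ℂ))⁻¹ • pv2 (e 0 - e 1) (e 2),
    ((Real.sqrt 2 : ℂ))⁻¹ • pv2 (e 2) (e 1 - e 2),
    ((Real.sqrt 2 : ℂ))⁻¹ • pv2 (e 1 - e 2) (e 0),
    (1 / 3 : ℂ) • pv2 (e 0 + e 1 + e 2) (e 0 + e 1 + e 2)]

lemma ip_smul_pv2 {ι κ : Type*} [Fintype ι] [Fintype κ] (r s : ℂ) (a c : ι → ℂ) (b d : κ → ℂ) :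
    ip (r • pv2 a b) (s • pv2 c d) = conj r * s * (ip a c * ip b d) := by
  simp only [ip, pv2, Pi.smul_apply, smul_eq_mul, map_mul]
  rw [Finset.sum_mul_sum, Fintype.sum_prod_type, Finset.mul_sum]
  simp only [Finset.mul_sum]
  refine Finset.sum_congr rfl fun i _ => Finset.sum_congr rfl fun j _ => ?_
  ring

lemma ip_fin_three (x y : Fin 3 → ℂ) :
    ip x y = conj (x 0) * y 0 + conj (x 1) * y 1 + conj (x 2) * y 2 :=
  Fin.sum_univ_three _

lemma ip_smul_pv2_left {ι κ : Type*} [Fintype ι] [Fintype κ] (r : ℂ) (a c : ι → ℂ) (b d : κ → ℂ) :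
    ip (r • pv2 a b) (pv2 c d) = conj r * (ip a c * ip b d) := by
  simpa using ip_smul_pv2 r 1 a c b d

lemma inv_sqrt_two_mul_self : ((Real.sqrt 2 : ℂ))⁻¹ * ((Real.sqrt 2 : ℂ))⁻¹ = 1 / 2 := by
  rw [← mul_inv, ← Complex.ofReal_mul, Real.mul_self_sqrt zero_le_two]
  norm_num

lemma ip_tiles_self (j : Fin 5) : ip (tiles j) (tiles j) = 1 := by
  fin_cases j <;>
    simp [tiles, ip_smul_pv2, inv_sqrt_two_mul_self, ip_fin_three, e] <;>
    norm_num [Complex.conj_ofNat]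

lemma ip_tiles_of_ne (j k : Fin 5) (h : j ≠ k) : ip (tiles j) (tiles k) = 0 := by
  fin_cases j <;> fin_cases k <;> first
    | exact absurd rfl h
    | simp [tiles, ip_smul_pv2, ip_fin_three, e]

/-- Five vectors cannot span a space of dimension nine. -/
lemma span_tiles_ne_top : Submodule.span ℂ (Set.range tiles) ≠ ⊤ := by
  intro h
  have hle := finrank_range_le_card (R := ℂ) tiles
  rw [Set.finrank, h, finrank_top, Module.finrank_fintype_fun_eq_card] at hle
  simp at hle

/-- Orthogonality to the five Tiles states, written in coordinates, forces a factor to vanish. -/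
lemma eq_zero_or_eq_zero_of_tiles_equations {K : Type*} [Field K] [CharZero K] {a b : Fin 3 → K}
    (h₀ : a 0 * (b 0 - b 1) = 0) (h₁ : (a 0 - a 1) * b 2 = 0) (h₂ : a 2 * (b 1 - b 2) = 0)
    (h₃ : (a 1 - a 2) * b 0 = 0) (h₄ : (a 0 + a 1 + a 2) * (b 0 + b 1 + b 2) = 0) :
    a = 0 ∨ b = 0 := by
  have key : (a 0 = 0 ∧ a 1 = 0 ∧ a 2 = 0) ∨ (b 0 = 0 ∧ b 1 = 0 ∧ b 2 = 0) := by
    simp only [mul_eq_zero] at h₀ h₁ h₂ h₃ h₄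
    rcases h₀ with h₀ | h₀ <;> rcases h₁ with h₁ | h₁ <;> rcases h₂ with h₂ | h₂ <;>
      rcases h₃ with h₃ | h₃ <;> rcases h₄ with h₄ | h₄ <;> grind
  simpa [funext_iff, Fin.forall_fin_succ] using key

lemma eq_zero_or_eq_zero_of_ip_tiles {a b : Fin 3 → ℂ} (h : ∀ j, ip (tiles j) (pv2 a b) = 0) :
    a = 0 ∨ b = 0 := by
  have h₀ := h 0
  have h₁ := h 1
  have h₂ := h 2
  have h₃ := h 3
  have h₄ := h 4
  simp [tiles, ip_smul_pv2_left, ip_fin_three, e,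
    ← sub_eq_add_neg] at h₀ h₁ h₂ h₃ h₄
  apply eq_zero_or_eq_zero_of_tiles_equations <;> simpa

/-- **Tiles is a UPB of ℂ³ ⊗ ℂ³.** -/
theorem tiles_is_UPB :
    (∀ j, ip (tiles j) (tiles j) = 1) ∧
    (∀ j k, j ≠ k → ip (tiles j) (tiles k) = 0) ∧
    Submodule.span ℂ (Set.range tiles) ≠ ⊤ ∧
    ¬ ∃ (a b : Fin 3 → ℂ), a ≠ 0 ∧ b ≠ 0 ∧ ∀ j, ip (tiles j) (pv2 a b) = 0 := by
  refine ⟨ip_tiles_self, ip_tiles_of_ne, span_tiles_ne_top, ?_⟩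
  rintro ⟨a, b, ha, hb, h⟩
  exact (eq_zero_or_eq_zero_of_ip_tiles h).elim ha hb

end
end

section
/- Let a = |1⟩⊗|+⟩, b = |+⟩⊗|0⟩, c = |0⟩⊗|1⟩, d = |−⟩⊗|−⟩ in ℂ² ⊗ ℂ² ≅ ℂ⁴. There exist unit vectors a^⊥, b^⊥ ∈ span{a, b} and c^⊥, d^⊥ ∈ span{c, d} with a^⊥ ⊥ a, b^⊥ ⊥ b, c^⊥ ⊥ c, d^⊥ ⊥ d, such that the eight vectors |0⟩⊗a, |1⟩⊗b, |+⟩⊗c, |−⟩⊗d, |0⟩⊗a^⊥, |1⟩⊗b^⊥, |+⟩⊗c^⊥, |−⟩⊗d^⊥ form an orthonormal basis of ℂ² ⊗ ℂ⁴. Consequently, the orthogonal complement of the span of the four Shifts states in ℂ² ⊗ (ℂ² ⊗ ℂ²) is spanned by vectors that are product across the A|(BC) cut. -/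
/-!
STATEMENT 8. With a = |1,+⟩, b = |+,0⟩, c = |0,1⟩, d = |−,−⟩ in ℂ²⊗ℂ² ≅ ℂ⁴, there exist
unit vectors a^⊥, b^⊥ ∈ span{a,b} and c^⊥, d^⊥ ∈ span{c,d}, orthogonal to a, b, c, d
respectively, such that |0⟩⊗a, |1⟩⊗b, |+⟩⊗c, |−⟩⊗d, |0⟩⊗a^⊥, |1⟩⊗b^⊥, |+⟩⊗c^⊥, |−⟩⊗d^⊥
is an orthonormal basis of ℂ² ⊗ ℂ⁴; consequently the orthogonal complement of the span
of the four Shifts states is spanned by vectors that are product across the A|(BC) cut.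
-/

open ComplexConjugate

noncomputable section

/-- `|0⟩ ∈ ℂ²`. -/
def q0 : Fin 2 → ℂ := Pi.single 0 1
/-- `|1⟩ ∈ ℂ²`. -/
def q1 : Fin 2 → ℂ := Pi.single 1 1
/-- `|+⟩ = (|0⟩ + |1⟩)/√2`. -/
def qPlus : Fin 2 → ℂ := ((Real.sqrt 2 : ℂ))⁻¹ • (q0 + q1)
/-- `|−⟩ = (|0⟩ − |1⟩)/√2`. -/
def qMinus : Fin 2 → ℂ := ((Real.sqrt 2 : ℂ))⁻¹ • (q0 - q1)

/-- `a = |1,+⟩ ∈ ℂ² ⊗ ℂ²`. -/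
def aV : Fin 2 × Fin 2 → ℂ := pv2 q1 qPlus
/-- `b = |+,0⟩`. -/
def bV : Fin 2 × Fin 2 → ℂ := pv2 qPlus q0
/-- `c = |0,1⟩`. -/
def cV : Fin 2 × Fin 2 → ℂ := pv2 q0 q1
/-- `d = |−,−⟩`. -/
def dV : Fin 2 × Fin 2 → ℂ := pv2 qMinus qMinus

/-- The Shifts states grouped across the A|(BC) cut:
`|0⟩⊗a, |1⟩⊗b, |+⟩⊗c, |−⟩⊗d` in ℂ² ⊗ ℂ⁴. -/
def shiftsA : Fin 4 → (Fin 2 × (Fin 2 × Fin 2) → ℂ) :=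
  ![pv2 q0 aV, pv2 q1 bV, pv2 qPlus cV, pv2 qMinus dV]

theorem conj_ip {ι : Type*} [Fintype ι] (x y : ι → ℂ) : conj (ip x y) = ip y x := by
  simp [ip, mul_comm]

theorem ip_eq_zero_comm {ι : Type*} [Fintype ι] {x y : ι → ℂ} : ip x y = 0 ↔ ip y x = 0 := by
  rw [← conj_ip x y, map_eq_zero]

theorem ip_add_right {ι : Type*} [Fintype ι] (x y z : ι → ℂ) :
    ip x (y + z) = ip x y + ip x z := by
  simp [ip, mul_add, Finset.sum_add_distrib]

theorem ip_sub_right {ι : Type*} [Fintype ι] (x y z : ι → ℂ) :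
    ip x (y - z) = ip x y - ip x z := by
  simp [ip, mul_sub, Finset.sum_sub_distrib]

theorem ip_smul_right {ι : Type*} [Fintype ι] (c : ℂ) (x y : ι → ℂ) :
    ip x (c • y) = c * ip x y := by
  simp [ip, Finset.mul_sum, mul_left_comm]

theorem ip_sub_left {ι : Type*} [Fintype ι] (x y z : ι → ℂ) :
    ip (x - y) z = ip x z - ip y z := by
  simp [ip, sub_mul, Finset.sum_sub_distrib]

theorem ip_smul_left {ι : Type*} [Fintype ι] (c : ℂ) (x y : ι → ℂ) :
    ip (c • x) y = conj c * ip x y := by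
  simp [ip, Finset.mul_sum, mul_assoc]

/-- The vectors orthogonal to `x`. -/
def ipOrth {ι : Type*} [Fintype ι] (x : ι → ℂ) : Submodule ℂ (ι → ℂ) where
  carrier := {y | ip x y = 0}
  add_mem' {y z} (hy : ip x y = 0) (hz : ip x z = 0) := by
    simp [ip_add_right, hy, hz]
  zero_mem' := by simp [ip]
  smul_mem' c y (hy : ip x y = 0) := by simp [ip_smul_right, hy]

theorem mem_ipOrth {ι : Type*} [Fintype ι] {x y : ι → ℂ} : y ∈ ipOrth x ↔ ip x y = 0 :=
  Iff.rfl

theorem ip_eq_zero_of_mem_span {ι : Type*} [Fintype ι] {S T : Set (ι → ℂ)}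
    (h : ∀ x ∈ S, ∀ y ∈ T, ip x y = 0) {x y : ι → ℂ}
    (hx : x ∈ Submodule.span ℂ S) (hy : y ∈ Submodule.span ℂ T) : ip x y = 0 := by
  have hS : ∀ z ∈ S, ip z y = 0 := fun z hz =>
    (Submodule.span_le (p := ipOrth z)).2 (fun t ht => h z hz t ht) hy
  exact ip_eq_zero_comm.1 <| (Submodule.span_le (p := ipOrth y)).2
    (fun t ht => mem_ipOrth.2 (ip_eq_zero_comm.1 (hS t ht))) hx

/-- Two unit vectors whose inner product has squared modulus `1/4` span a plane containing a
unit vector orthogonal to the first. -/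
theorem exists_unit_orthogonal {ι : Type*} [Fintype ι] {x y : ι → ℂ}
    (hx : ip x x = 1) (hy : ip y y = 1) (hxy : ip x y * ip y x = 1 / 4) :
    ∃ z ∈ Submodule.span ℂ {x, y}, ip z z = 1 ∧ ip x z = 0 := by
  refine ⟨((2 / √3 : ℝ) : ℂ) • (y - ip x y • x), ?_, ?_, ?_⟩
  · exact Submodule.smul_mem _ _ <| Submodule.sub_mem _ (Submodule.subset_span (by simp))
      (Submodule.smul_mem _ _ (Submodule.subset_span (by simp)))
  · have h3 : ((2 / √3 : ℝ) : ℂ) * ((2 / √3 : ℝ) : ℂ) = 4 / 3 := by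
      rw [← Complex.ofReal_mul, div_mul_div_comm, Real.mul_self_sqrt (by norm_num)]
      norm_num
    simp only [ip_smul_left, ip_smul_right, ip_sub_left, ip_sub_right, conj_ip, hx, hy,
      Complex.conj_ofReal]
    linear_combination (1 - ip x y * ip y x) * h3 - 4 / 3 * hxy
  · simp [ip_smul_right, ip_sub_right, hx]

/-- Parseval expansion in an orthonormal family of full cardinality. -/
theorem sum_ip_smul_eq {ι σ : Type*} [Fintype ι] [Fintype σ] [DecidableEq σ]
    (hcard : Fintype.card σ = Fintype.card ι) {v : σ → ι → ℂ}
    (hv : ∀ s t, ip (v s) (v t) = if s = t then 1 else 0) (w : ι → ℂ) :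
    ∑ s, ip (v s) w • v s = w := by
  classical
  have h : (Matrix.of fun s i => conj (v s i)) * (Matrix.of fun i s => v s i) = 1 := by
    ext s t
    simpa [Matrix.mul_apply, Matrix.one_apply, ip] using hv s t
  have h' := (Matrix.mul_eq_one_comm_of_card_eq _ _ _ hcard).1 h
  have h'' := congrArg (Matrix.mulVec · w) h'
  simp only [← Matrix.mulVec_mulVec, Matrix.one_mulVec] at h''
  refine Eq.trans ?_ h''
  ext i
  simp [Matrix.mulVec, dotProduct, ip, mul_comm]

theorem ofReal_sqrt_two_inv_mul_self : ((√2 : ℝ) : ℂ)⁻¹ * ((√2 : ℝ) : ℂ)⁻¹ = 1 / 2 := by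
  rw [← mul_inv, ← Complex.ofReal_mul, Real.mul_self_sqrt (by norm_num)]
  norm_num

theorem ip_q0_q0 : ip q0 q0 = 1 := by simp [ip, q0]
theorem ip_q1_q1 : ip q1 q1 = 1 := by simp [ip, q1]
theorem ip_q0_q1 : ip q0 q1 = 0 := by simp [ip, q0, q1]
theorem ip_q0_qPlus : ip q0 qPlus = ((√2 : ℝ) : ℂ)⁻¹ := by simp [ip, q0, q1, qPlus]
theorem ip_q1_qPlus : ip q1 qPlus = ((√2 : ℝ) : ℂ)⁻¹ := by simp [ip, q0, q1, qPlus]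
theorem ip_q0_qMinus : ip q0 qMinus = ((√2 : ℝ) : ℂ)⁻¹ := by simp [ip, q0, q1, qMinus]
theorem ip_q1_qMinus : ip q1 qMinus = -((√2 : ℝ) : ℂ)⁻¹ := by simp [ip, q0, q1, qMinus]

theorem ip_qPlus_qPlus : ip qPlus qPlus = 1 := by
  simp [ip, q0, q1, qPlus]
  linear_combination 2 * ofReal_sqrt_two_inv_mul_self

theorem ip_qMinus_qMinus : ip qMinus qMinus = 1 := by
  simp [ip, q0, q1, qMinus]
  linear_combination 2 * ofReal_sqrt_two_inv_mul_self

theorem ip_qPlus_qMinus : ip qPlus qMinus = 0 := by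
  simp [ip, q0, q1, qPlus, qMinus]

theorem ip_aV_aV : ip aV aV = 1 := by simp [aV, ip_pv2, ip_q1_q1, ip_qPlus_qPlus]
theorem ip_bV_bV : ip bV bV = 1 := by simp [bV, ip_pv2, ip_q0_q0, ip_qPlus_qPlus]
theorem ip_cV_cV : ip cV cV = 1 := by simp [cV, ip_pv2, ip_q0_q0, ip_q1_q1]
theorem ip_dV_dV : ip dV dV = 1 := by simp [dV, ip_pv2, ip_qMinus_qMinus]

theorem ip_aV_bV : ip aV bV = 1 / 2 := by
  rw [aV, bV, ip_pv2, ← conj_ip q0, ip_q1_qPlus, ip_q0_qPlus, map_inv₀, Complex.conj_ofReal,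
    ofReal_sqrt_two_inv_mul_self]

theorem ip_cV_dV : ip cV dV = -(1 / 2) := by
  rw [cV, dV, ip_pv2, ip_q0_qMinus, ip_q1_qMinus, mul_neg, ofReal_sqrt_two_inv_mul_self]

theorem ip_eq_zero_of_mem_span_aV_bV_of_mem_span_cV_dV {x y : Fin 2 × Fin 2 → ℂ}
    (hx : x ∈ Submodule.span ℂ {aV, bV}) (hy : y ∈ Submodule.span ℂ {cV, dV}) :
    ip x y = 0 := by
  refine ip_eq_zero_of_mem_span ?_ hx hy
  simp [aV, bV, cV, dV, ip_pv2, ip_q0_q1, ip_eq_zero_comm.1 ip_q0_q1, ip_qPlus_qMinus]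

/-- **Completion of Shifts across the A|(BC) cut by product vectors.** -/
theorem shifts_A_BC_product_completion :
    ∃ aP bP cP dP : Fin 2 × Fin 2 → ℂ,
      ip aP aP = 1 ∧ ip bP bP = 1 ∧ ip cP cP = 1 ∧ ip dP dP = 1 ∧
      aP ∈ Submodule.span ℂ {aV, bV} ∧ bP ∈ Submodule.span ℂ {aV, bV} ∧
      cP ∈ Submodule.span ℂ {cV, dV} ∧ dP ∈ Submodule.span ℂ {cV, dV} ∧
      ip aV aP = 0 ∧ ip bV bP = 0 ∧ ip cV cP = 0 ∧ ip dV dP = 0 ∧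
      (∀ s t : Fin 8,
        ip ((Fin.append shiftsA ![pv2 q0 aP, pv2 q1 bP, pv2 qPlus cP, pv2 qMinus dP]) s)
           ((Fin.append shiftsA ![pv2 q0 aP, pv2 q1 bP, pv2 qPlus cP, pv2 qMinus dP]) t)
          = if s = t then 1 else 0) ∧
      Submodule.span ℂ
          (Set.range (Fin.append shiftsA ![pv2 q0 aP, pv2 q1 bP, pv2 qPlus cP, pv2 qMinus dP]))
        = ⊤ ∧
      {w : Fin 2 × (Fin 2 × Fin 2) → ℂ | ∀ j, ip (shiftsA j) w = 0} =
        (Submodule.span ℂ {pv2 q0 aP, pv2 q1 bP, pv2 qPlus cP, pv2 qMinus dP} :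
          Submodule ℂ (Fin 2 × (Fin 2 × Fin 2) → ℂ)) := by
  obtain ⟨aP, haP, haP1, haP0⟩ := exists_unit_orthogonal ip_aV_aV ip_bV_bV
    (by rw [← conj_ip aV bV, ip_aV_bV]; norm_num [map_ofNat])
  obtain ⟨bP, hbP, hbP1, hbP0⟩ := exists_unit_orthogonal ip_bV_bV ip_aV_aV
    (by rw [← conj_ip aV bV, ip_aV_bV]; norm_num [map_ofNat])
  obtain ⟨cP, hcP, hcP1, hcP0⟩ := exists_unit_orthogonal ip_cV_cV ip_dV_dV
    (by rw [← conj_ip cV dV, ip_cV_dV]; norm_num [map_ofNat])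
  obtain ⟨dP, hdP, hdP1, hdP0⟩ := exists_unit_orthogonal ip_dV_dV ip_cV_cV
    (by rw [← conj_ip cV dV, ip_cV_dV]; norm_num [map_ofNat])
  rw [Set.pair_comm] at hbP hdP
  have haV : aV ∈ Submodule.span ℂ {aV, bV} := Submodule.subset_span (by simp)
  have hbV : bV ∈ Submodule.span ℂ {aV, bV} := Submodule.subset_span (by simp)
  have hcV : cV ∈ Submodule.span ℂ {cV, dV} := Submodule.subset_span (by simp)
  have hdV : dV ∈ Submodule.span ℂ {cV, dV} := Submodule.subset_span (by simp)
  have hort : ∀ s t : Fin 8,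
      ip ((Fin.append shiftsA ![pv2 q0 aP, pv2 q1 bP, pv2 qPlus cP, pv2 qMinus dP]) s)
         ((Fin.append shiftsA ![pv2 q0 aP, pv2 q1 bP, pv2 qPlus cP, pv2 qMinus dP]) t)
        = if s = t then 1 else 0 := by
    have h1 {x y} := @ip_eq_zero_of_mem_span_aV_bV_of_mem_span_cV_dV x y
    have h2 {x y} (hx : x ∈ Submodule.span ℂ {aV, bV}) (hy : y ∈ Submodule.span ℂ {cV, dV}) :
        ip y x = 0 := ip_eq_zero_comm.1 (h1 hx hy)
    have happ : Fin.append shiftsA ![pv2 q0 aP, pv2 q1 bP, pv2 qPlus cP, pv2 qMinus dP] =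
        ![pv2 q0 aV, pv2 q1 bV, pv2 qPlus cV, pv2 qMinus dV,
          pv2 q0 aP, pv2 q1 bP, pv2 qPlus cP, pv2 qMinus dP] := by
      ext s : 1
      fin_cases s <;> rfl
    rw [happ]
    generalize Submodule.span ℂ {aV, bV} = S at *
    generalize Submodule.span ℂ {cV, dV} = T at *
    intro s t
    fin_cases s <;> fin_cases t <;>
      simp [ip_pv2, ip_q0_q0, ip_q1_q1, ip_qPlus_qPlus, ip_qMinus_qMinus, ip_q0_q1,
        ip_eq_zero_comm.1 ip_q0_q1, ip_qPlus_qMinus, ip_eq_zero_comm.1 ip_qPlus_qMinus,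
        ip_aV_aV, ip_bV_bV, ip_cV_cV, ip_dV_dV, haP1, hbP1, hcP1, hdP1, haP0, hbP0, hcP0, hdP0,
        ip_eq_zero_comm.1 haP0, ip_eq_zero_comm.1 hbP0, ip_eq_zero_comm.1 hcP0,
        ip_eq_zero_comm.1 hdP0, h1, h2, haV, hbV, hcV, hdV, haP, hbP, hcP, hdP]
  have hsum := sum_ip_smul_eq (by simp) hort
  refine ⟨aP, bP, cP, dP, haP1, hbP1, hcP1, hdP1, haP, hbP, hcP, hdP, haP0, hbP0, hcP0, hdP0,
    hort, ?_, ?_⟩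
  · refine eq_top_iff.2 fun w _ => ?_
    rw [← hsum w]
    exact Submodule.sum_mem _ fun s _ =>
      Submodule.smul_mem _ _ (Submodule.subset_span (Set.mem_range_self s))
  · have hrange : ({pv2 q0 aP, pv2 q1 bP, pv2 qPlus cP, pv2 qMinus dP} : Set _) =
        Set.range ![pv2 q0 aP, pv2 q1 bP, pv2 qPlus cP, pv2 qMinus dP] := by
      simp only [Matrix.range_cons, Matrix.range_empty, Set.union_empty, Set.singleton_union]
    rw [hrange]
    ext w
    refine ⟨fun hw => ?_, fun hw j => ?_⟩
    · have h := hsum w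
      rw [Fin.sum_univ_add (a := 4) (b := 4)] at h
      simp only [Fin.append_left, Fin.append_right, hw _, zero_smul, Finset.sum_const_zero,
        zero_add] at h
      rw [← h]
      exact Submodule.sum_mem _ fun s _ =>
        Submodule.smul_mem _ _ (Submodule.subset_span (Set.mem_range_self s))
    · refine (Submodule.span_le (p := ipOrth (shiftsA j))).2 ?_ hw
      rintro _ ⟨k, rfl⟩
      have h := hort (Fin.castAdd 4 j) (Fin.natAdd 4 k)
      rw [Fin.append_left, Fin.append_right, if_neg (by simp [Fin.ext_iff]; omega)] at h
      exact h

end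
end

section
/- Let S be an unextendible product basis in ⊗_{i=1}^m ℂ^{d_i}. Then for any dimensions D_i ≥ d_i and any linear isometries ι_i : ℂ^{d_i} → ℂ^{D_i} (i = 1,…,m), there is no orthonormal basis of ⊗_{i=1}^m ℂ^{D_i} consisting entirely of product vectors that contains the image set {(ι_1 ⊗ ⋯ ⊗ ι_m)ψ : ψ ∈ S}. That is, a UPB is not completable even in a locally extended Hilbert space. -/
/-!
STATEMENT 12 (Lemma 2). A UPB is not completable even in a locally extended Hilbert space:
if S is a UPB in ⊗_{i=1}^m ℂ^{d_i}, then for any D_i ≥ d_i and local isometries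
ι_i : ℂ^{d_i} → ℂ^{D_i}, no orthonormal basis of ⊗_i ℂ^{D_i} consisting entirely of product
vectors contains the image set {(ι_1⊗⋯⊗ι_m)ψ : ψ ∈ S}.
-/

open ComplexConjugate

noncomputable section

/-- The hermitian adjoint of `T`, with respect to the inner product `ip`. -/
def ipAdjoint {ι κ : Type*} [Fintype κ] [DecidableEq ι] (T : (ι → ℂ) →ₗ[ℂ] (κ → ℂ))
    (y : κ → ℂ) : ι → ℂ :=
  fun k => ip (T (Pi.single k 1)) y

theorem ip_ipAdjoint {ι κ : Type*} [Fintype ι] [Fintype κ] [DecidableEq ι]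
    (T : (ι → ℂ) →ₗ[ℂ] (κ → ℂ)) (x : ι → ℂ) (y : κ → ℂ) :
    ip x (ipAdjoint T y) = ip (T x) y := by
  have hx : T x = ∑ k, x k • T (Pi.single k 1) := by
    conv_lhs => rw [pi_eq_sum_univ' x]
    simp [map_sum]
  simp only [hx, ip, ipAdjoint, Finset.mul_sum, Finset.sum_apply, Pi.smul_apply, smul_eq_mul,
    map_sum, map_mul, Finset.sum_mul]
  rw [Finset.sum_comm]
  simp only [mul_assoc]

theorem ip_single_one {ι : Type*} [Fintype ι] [DecidableEq ι] (k : ι) (x : ι → ℂ) :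
    ip (Pi.single k 1) x = x k := by
  simp [ip, Pi.single_apply, apply_ite conj]

theorem ipAdjoint_apply_of_isometry {ι κ : Type*} [Fintype ι] [Fintype κ] [DecidableEq ι]
    (T : (ι → ℂ) →ₗ[ℂ] (κ → ℂ)) (hT : ∀ x y, ip (T x) (T y) = ip x y) (x : ι → ℂ) :
    ipAdjoint T (T x) = x := by
  ext k
  rw [ipAdjoint, hT, ip_single_one]

/-- The tensor product of the adjoints of the local maps `L i`. -/
def tensorAdjoint {m : ℕ} {d D : Fin m → ℕ}
    (L : ∀ i, (Fin (d i) → ℂ) →ₗ[ℂ] (Fin (D i) → ℂ)) :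
    ((∀ i, Fin (D i)) → ℂ) →ₗ[ℂ] ((∀ i, Fin (d i)) → ℂ) where
  toFun w f := ip (prodVec fun i => L i (Pi.single (f i) 1)) w
  map_add' v w := by
    ext f
    simp [ip, mul_add, Finset.sum_add_distrib]
  map_smul' c w := by
    ext f
    simp [ip, Finset.mul_sum, mul_left_comm]

theorem tensorAdjoint_prodVec {m : ℕ} {d D : Fin m → ℕ}
    (L : ∀ i, (Fin (d i) → ℂ) →ₗ[ℂ] (Fin (D i) → ℂ)) (χ : ∀ i, Fin (D i) → ℂ) :
    tensorAdjoint L (prodVec χ) = prodVec fun i => ipAdjoint (L i) (χ i) := by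
  ext f
  exact ip_prodVec _ _

theorem prodVec_single_one {m : ℕ} {d : Fin m → ℕ} (f : ∀ i, Fin (d i)) :
    (prodVec fun i => Pi.single (f i) 1) = Pi.single f (1 : ℂ) := by
  ext g
  by_cases h : g = f
  · simp [prodVec, h]
  · obtain ⟨i, hi⟩ := Function.ne_iff.mp h
    rw [Pi.single_eq_of_ne h]
    exact Finset.prod_eq_zero (Finset.mem_univ i) (Pi.single_eq_of_ne hi _)

theorem prodVec_eq_zero {m : ℕ} {d : Fin m → ℕ} {φ : ∀ i, Fin (d i) → ℂ} {i : Fin m}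
    (h : φ i = 0) : prodVec φ = 0 := by
  ext f
  exact Finset.prod_eq_zero (Finset.mem_univ i) (by rw [h]; rfl)

/-- **A UPB is not completable in any locally extended Hilbert space.**
Here the UPB has members `ψ_j = ⊗_i φ_{i,j}`, each `L i` is a linear isometry
`ℂ^{d_i} → ℂ^{D_i}` (it preserves the inner product), and the image of `ψ_j` under
`L_1 ⊗ ⋯ ⊗ L_m` is `⊗_i (L i (φ i j))`. -/
theorem upb_not_completable_in_extension {m n : ℕ} {d D : Fin m → ℕ}
    (φ : ∀ i : Fin m, Fin n → (Fin (d i) → ℂ))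
    (hnz : ∀ i j, φ i j ≠ 0)
    (hunit : ∀ j, ip (prodVec fun i => φ i j) (prodVec fun i => φ i j) = 1)
    (horth : ∀ j k, j ≠ k →
      ip (prodVec fun i => φ i j) (prodVec fun i => φ i k) = 0)
    (hproper : Submodule.span ℂ (Set.range fun j => prodVec fun i => φ i j) ≠ ⊤)
    (hupb : ¬ ∃ χ : ∀ i, Fin (d i) → ℂ, (∀ i, χ i ≠ 0) ∧
        ∀ j, ip (prodVec fun i => φ i j) (prodVec χ) = 0)
    (hdD : ∀ i, d i ≤ D i)
    (L : ∀ i, (Fin (d i) → ℂ) →ₗ[ℂ] (Fin (D i) → ℂ))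
    (hL : ∀ i x y, ip (L i x) (L i y) = ip x y) :
    ¬ ∃ (N : ℕ) (b : Fin N → ((∀ i, Fin (D i)) → ℂ)),
        (∀ s t, ip (b s) (b t) = if s = t then 1 else 0) ∧
        (∀ s, ∃ χ : ∀ i, Fin (D i) → ℂ, (∀ i, χ i ≠ 0) ∧ b s = prodVec χ) ∧
        Submodule.span ℂ (Set.range b) = ⊤ ∧
        (∀ j, ∃ s, b s = prodVec fun i => L i (φ i j)) := by
  rintro ⟨N, b, hb, hprod, hspan, himg⟩
  apply hproper
  set K := Submodule.span ℂ (Set.range fun j => prodVec fun i => φ i j)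
  have himage (x : ∀ i, Fin (d i) → ℂ) :
      tensorAdjoint L (prodVec fun i => L i (x i)) = prodVec x := by
    simp only [tensorAdjoint_prodVec, ipAdjoint_apply_of_isometry _ (hL _)]
  have hmem (s : Fin N) : tensorAdjoint L (b s) ∈ K := by
    by_cases hs : ∃ j, b s = prodVec fun i => L i (φ i j)
    · obtain ⟨j, hj⟩ := hs
      rw [hj, himage]
      exact Submodule.subset_span ⟨j, rfl⟩
    · obtain ⟨χ, -, hχ⟩ := hprod s
      have hzero : ∃ i, ipAdjoint (L i) (χ i) = 0 := by
        by_contra! hne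
        refine hupb ⟨_, hne, fun j => ?_⟩
        obtain ⟨t, ht⟩ := himg j
        have hts : t ≠ s := by
          rintro rfl
          exact hs ⟨j, ht⟩
        have h0 := hb t s
        rw [if_neg hts, ht, hχ, ip_prodVec] at h0
        simpa only [ip_prodVec, ip_ipAdjoint] using h0
      obtain ⟨i, hi⟩ := hzero
      rw [hχ, tensorAdjoint_prodVec, prodVec_eq_zero hi]
      exact K.zero_mem
  have hrange (w : (∀ i, Fin (D i)) → ℂ) : tensorAdjoint L w ∈ K := by
    have hle : Submodule.span ℂ (Set.range b) ≤ K.comap (tensorAdjoint L) :=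
      Submodule.span_le.mpr (Set.range_subset_iff.mpr hmem)
    exact hle (hspan ▸ Submodule.mem_top)
  rw [eq_top_iff]
  intro v _
  rw [pi_eq_sum_univ' v]
  refine K.sum_mem fun f _ => K.smul_mem _ ?_
  rw [← prodVec_single_one, ← himage]
  exact hrange _

end
end
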